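/- Let m > 0, ν ∈ (0, 1/m], and let c > 0 satisfy J_ν(2c/m) + 2c·J′_ν(2c/m) = 0 with 2c/m ∈ (0, j_ν). Let f be an absolutely continuous function on [0, 1] with f(0) = 0 and f′(x)/x ∈ L¹[0, 1]. Then ((1 − ν²m²)/4)·∫₀¹ |f(x)|/x² dx + c²·∫₀¹ |f(x)|/x^{2−m} dx ≤ ((1 + νm)/2)·∫₀¹ |f′(x)|/x dx. -/

import Mathlib

open MeasureTheory Real Set Filter

/-- Bessel function of the first kind of real order `ν`, defined for `x > 0` by its series. -/
noncomputable def besselJ (ν x : ℝ) : ℝ :=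
  ∑' k : ℕ, (-1 : ℝ) ^ k * x ^ (2 * (k : ℝ) + ν) /
    (2 ^ (2 * (k : ℝ) + ν) * (Nat.factorial k : ℝ) * Real.Gamma ((k : ℝ) + 1 + ν))

section PowerSeries

lemma summable_mul_pow_of_abs_le_div_factorial {a : ℕ → ℝ} {C : ℝ}
    (ha : ∀ k, |a k| ≤ C / (k.factorial : ℝ)) (s : ℝ) :
    Summable (fun k => a k * s ^ k) := by
  have h : Summable (fun k : ℕ => C * (|s| ^ k / (k.factorial : ℝ))) :=
    (Real.summable_pow_div_factorial |s|).mul_left C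
  refine Summable.of_norm_bounded h fun k => ?_
  rw [Real.norm_eq_abs, abs_mul, abs_pow]
  calc |a k| * |s| ^ k ≤ C / (k.factorial : ℝ) * |s| ^ k := by gcongr; exact ha k
    _ = _ := by ring

lemma abs_succ_mul_succ_le_div_factorial {a : ℕ → ℝ} {C : ℝ}
    (ha : ∀ k, |a k| ≤ C / (k.factorial : ℝ)) (k : ℕ) :
    |((k : ℝ) + 1) * a (k + 1)| ≤ C / (k.factorial : ℝ) := by
  have hk : (0 : ℝ) < (k : ℝ) + 1 := by positivity
  have hf : (0 : ℝ) < (k.factorial : ℝ) := by positivity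
  rw [abs_mul, abs_of_pos hk]
  calc ((k : ℝ) + 1) * |a (k + 1)| ≤ ((k : ℝ) + 1) * (C / ((k + 1).factorial : ℝ)) := by
        gcongr; exact ha (k + 1)
    _ = _ := by rw [Nat.factorial_succ]; push_cast; field_simp

lemma hasDerivAt_tsum_of_abs_le_div_factorial {a : ℕ → ℝ} {C : ℝ}
    (ha : ∀ k, |a k| ≤ C / (k.factorial : ℝ)) (s : ℝ) :
    HasDerivAt (fun s => ∑' k, a k * s ^ k)
      (∑' k : ℕ, (((k : ℝ) + 1) * a (k + 1)) * s ^ k) s := by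
  set R := |s| + 1
  have hb := abs_succ_mul_succ_le_div_factorial ha
  have hu : Summable (fun k : ℕ => |a k| * ((k : ℝ) * R ^ (k - 1))) := by
    rw [← summable_nat_add_iff 1]
    have := (summable_mul_pow_of_abs_le_div_factorial (a := fun k => |((k : ℝ) + 1) * a (k + 1)|)
      (C := C) (fun k => by rw [abs_abs]; exact hb k) R)
    refine this.congr fun k => ?_
    rw [abs_mul, abs_of_pos (by positivity : (0 : ℝ) < (k : ℝ) + 1)]
    simp only [Nat.add_sub_cancel]
    push_cast
    ring
  have hd := hasDerivAt_tsum_of_isPreconnected (g := fun k s => a k * s ^ k)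
    (g' := fun k s => a k * ((k : ℝ) * s ^ (k - 1))) (t := Metric.ball (0 : ℝ) R) (y₀ := 0) (y := s)
    hu Metric.isOpen_ball (convex_ball _ _).isPreconnected
    (fun k y _ => (hasDerivAt_pow k y).const_mul (a k))
    (fun k y hy => by
      rw [Real.norm_eq_abs, abs_mul, abs_mul, abs_pow, Nat.abs_cast]
      have : |y| ≤ R := by simpa using (mem_ball_zero_iff.1 hy).le
      gcongr)
    (Metric.mem_ball_self (by positivity)) (summable_mul_pow_of_abs_le_div_factorial ha 0)
    (by simp [R])
  have hs : Summable (fun k : ℕ => a k * ((k : ℝ) * s ^ (k - 1))) := by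
    rw [← summable_nat_add_iff 1]
    refine (summable_mul_pow_of_abs_le_div_factorial hb s).congr fun k => ?_
    simp only [Nat.add_sub_cancel]; push_cast; ring
  refine hd.congr_deriv ?_
  rw [hs.tsum_eq_zero_add]
  simp only [CharP.cast_eq_zero, zero_mul, mul_zero, zero_add, Nat.add_sub_cancel]
  refine tsum_congr fun k => ?_
  push_cast; ring

end PowerSeries

/-- The Taylor coefficients of the entire function `Φ` with `J_ν(x) = x ^ ν * Φ(x ^ 2)`. -/
noncomputable def besselCoeff (ν : ℝ) (k : ℕ) : ℝ :=
  (-1 : ℝ) ^ k /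
    (2 ^ (2 * (k : ℝ) + ν) * (Nat.factorial k : ℝ) * Real.Gamma ((k : ℝ) + 1 + ν))

/-- The Taylor coefficients of the derivative of the normalised Bessel function. -/
noncomputable def besselCoeffDeriv (ν : ℝ) (k : ℕ) : ℝ :=
  ((k : ℝ) + 1) * besselCoeff ν (k + 1)

/-- The entire function `Φ` with `J_ν(x) = x ^ ν * Φ(x ^ 2)`. -/
noncomputable def besselNormalized (ν s : ℝ) : ℝ := ∑' k, besselCoeff ν k * s ^ k

/-- The derivative of `besselNormalized ν`. -/
noncomputable def besselNormalizedDeriv (ν s : ℝ) : ℝ := ∑' k, besselCoeffDeriv ν k * s ^ k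

/-- The second derivative of `besselNormalized ν`. -/
noncomputable def besselNormalizedDeriv₂ (ν s : ℝ) : ℝ :=
  ∑' k : ℕ, (((k : ℝ) + 1) * besselCoeffDeriv ν (k + 1)) * s ^ k

section Bessel

variable {ν : ℝ}

lemma besselCoeff_succ (hν : 0 < ν) (k : ℕ) :
    4 * ((k : ℝ) + 1) * ((k : ℝ) + 1 + ν) * besselCoeff ν (k + 1) = - besselCoeff ν k := by
  have hk : (0 : ℝ) < (k : ℝ) + 1 + ν := by positivity
  have hG := Real.Gamma_pos_of_pos hk
  have h2 : (0 : ℝ) < 2 ^ (2 * (k : ℝ) + ν) := by positivity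
  have hf : (0 : ℝ) < (k.factorial : ℝ) := by positivity
  unfold besselCoeff
  rw [Nat.factorial_succ]
  push_cast
  rw [show (k : ℝ) + 1 + 1 + ν = ((k : ℝ) + 1 + ν) + 1 by ring, Real.Gamma_add_one hk.ne',
    show 2 * ((k : ℝ) + 1) + ν = (2 * (k : ℝ) + ν) + 2 by ring,
    Real.rpow_add (by norm_num : (0 : ℝ) < 2), pow_succ,
    show ((2 : ℝ) ^ (2 : ℝ)) = 4 by norm_num]
  field_simp

lemma abs_besselCoeff_le (hν : 0 < ν) (k : ℕ) :
    |besselCoeff ν k| ≤ |besselCoeff ν 0| / (k.factorial : ℝ) := by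
  induction k with
  | zero => simp
  | succ k ih =>
    have h := congrArg abs (besselCoeff_succ hν k)
    have hk : (0 : ℝ) < (k : ℝ) + 1 := by positivity
    have hf : (0 : ℝ) < (k.factorial : ℝ) := by positivity
    have hp : (0 : ℝ) < 4 * ((k : ℝ) + 1) * ((k : ℝ) + 1 + ν) := by positivity
    rw [abs_mul, abs_of_pos hp, abs_neg] at h
    rw [Nat.factorial_succ]
    push_cast
    rw [le_div_iff₀ (by positivity)]
    rw [le_div_iff₀ hf] at ih
    have h1 : ((k : ℝ) + 1) * |besselCoeff ν (k + 1)| ≤ |besselCoeff ν k| := by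
      rw [← h]
      gcongr
      have : (0 : ℝ) ≤ k := by positivity
      nlinarith
    calc |besselCoeff ν (k + 1)| * (((k : ℝ) + 1) * (k.factorial : ℝ))
        = (((k : ℝ) + 1) * |besselCoeff ν (k + 1)|) * (k.factorial : ℝ) := by ring
      _ ≤ |besselCoeff ν k| * (k.factorial : ℝ) := by gcongr
      _ ≤ _ := ih

lemma hasDerivAt_besselNormalized (hν : 0 < ν) (s : ℝ) :
    HasDerivAt (besselNormalized ν) (besselNormalizedDeriv ν s) s :=
  hasDerivAt_tsum_of_abs_le_div_factorial (abs_besselCoeff_le hν) s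

lemma hasDerivAt_besselNormalizedDeriv (hν : 0 < ν) (s : ℝ) :
    HasDerivAt (besselNormalizedDeriv ν) (besselNormalizedDeriv₂ ν s) s :=
  hasDerivAt_tsum_of_abs_le_div_factorial
    (abs_succ_mul_succ_le_div_factorial (abs_besselCoeff_le hν)) s

/-- Bessel's differential equation for the normalised function. -/
lemma besselNormalized_ode (hν : 0 < ν) (s : ℝ) :
    s * besselNormalizedDeriv₂ ν s + (ν + 1) * besselNormalizedDeriv ν s
      + besselNormalized ν s / 4 = 0 := by
  have ha := abs_besselCoeff_le hν
  have hb : ∀ k, |besselCoeffDeriv ν k| ≤ _ := abs_succ_mul_succ_le_div_factorial ha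
  have sa := summable_mul_pow_of_abs_le_div_factorial ha s
  have sb := summable_mul_pow_of_abs_le_div_factorial hb s
  have sd := summable_mul_pow_of_abs_le_div_factorial (abs_succ_mul_succ_le_div_factorial hb) s
  have sk : Summable (fun k : ℕ => (k : ℝ) * besselCoeffDeriv ν k * s ^ k) := by
    rw [← summable_nat_add_iff 1]
    refine (sd.mul_left s).congr fun k => ?_
    push_cast; ring
  have h1 : s * besselNormalizedDeriv₂ ν s
      = ∑' k : ℕ, (k : ℝ) * besselCoeffDeriv ν k * s ^ k := by
    rw [sk.tsum_eq_zero_add, besselNormalizedDeriv₂, ← tsum_mul_left]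
    simp only [CharP.cast_eq_zero, zero_mul, zero_add]
    refine tsum_congr fun k => ?_
    push_cast; ring
  rw [h1, besselNormalizedDeriv, besselNormalized, ← tsum_mul_left, ← tsum_div_const,
    ← sk.tsum_add (sb.mul_left _), ← (sk.add (sb.mul_left _)).tsum_add (sa.div_const 4)]
  refine (tsum_congr fun k => ?_).trans tsum_zero
  have := besselCoeff_succ hν k
  rw [besselCoeffDeriv]
  linear_combination s ^ k / 4 * this

lemma besselJ_eq {x : ℝ} (hx : 0 < x) : besselJ ν x = x ^ ν * besselNormalized ν (x ^ 2) := by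
  rw [besselJ, besselNormalized, ← tsum_mul_left]
  refine tsum_congr fun k => ?_
  rw [besselCoeff, Real.rpow_add hx, ← pow_mul, ← Real.rpow_natCast x (2 * k)]
  push_cast
  ring

lemma hasDerivAt_besselJ (hν : 0 < ν) {x : ℝ} (hx : 0 < x) :
    HasDerivAt (besselJ ν) (ν * x ^ (ν - 1) * besselNormalized ν (x ^ 2)
      + x ^ ν * (besselNormalizedDeriv ν (x ^ 2) * (2 * x))) x := by
  have h1 := Real.hasDerivAt_rpow_const (x := x) (p := ν) (Or.inl hx.ne')
  have h2 := (hasDerivAt_besselNormalized hν (x ^ 2)).comp x (hasDerivAt_pow 2 x)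
  have h3 := h1.mul h2
  refine (h3.congr_of_eventuallyEq ?_).congr_deriv ?_
  · filter_upwards [lt_mem_nhds hx] with y hy
    simpa using besselJ_eq hy
  · simp

/-- While the normalised Bessel function stays nonnegative it is decreasing. -/
lemma besselNormalizedDeriv_nonpos (hν : 0 < ν) {s : ℝ} (hs : 0 < s)
    (hpos : ∀ r ∈ Ioo 0 s, 0 ≤ besselNormalized ν r) : besselNormalizedDeriv ν s ≤ 0 := by
  have hcont : Continuous (besselNormalizedDeriv ν) :=
    continuous_iff_continuousAt.2 fun r => (hasDerivAt_besselNormalizedDeriv hν r).continuousAt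
  have hanti : AntitoneOn (fun r : ℝ => r ^ (ν + 1) * besselNormalizedDeriv ν r) (Icc 0 s) := by
    refine antitoneOn_of_hasDerivWithinAt_nonpos (convex_Icc 0 s)
      (f' := fun r => - (r ^ ν * besselNormalized ν r / 4)) ?_ ?_ ?_
    · exact ((Real.continuous_rpow_const (by positivity)).mul hcont).continuousOn
    · intro r hr
      rw [interior_Icc] at hr
      have h1 := Real.hasDerivAt_rpow_const (x := r) (p := ν + 1) (Or.inl hr.1.ne')
      refine ((h1.mul (hasDerivAt_besselNormalizedDeriv hν r)).congr_deriv ?_).hasDerivWithinAt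
      rw [add_sub_cancel_right, Real.rpow_add_one hr.1.ne']
      linear_combination r ^ ν * besselNormalized_ode hν r
    · intro r hr
      rw [interior_Icc] at hr
      have := hpos r hr
      have := Real.rpow_nonneg hr.1.le ν
      simp only [Left.neg_nonpos_iff]
      positivity
  have h := hanti (left_mem_Icc.2 hs.le) (right_mem_Icc.2 hs.le) hs.le
  simp only [Real.zero_rpow (by positivity : ν + 1 ≠ 0), zero_mul] at h
  exact nonpos_of_mul_nonpos_right h (Real.rpow_pos_of_pos hs _)

/-- The logarithmic derivative of `x ^ (1 / 2) * J_ν ((2 * c / m) * x ^ (m / 2))`. -/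
noncomputable def besselLogDeriv (m ν c x : ℝ) : ℝ :=
  (1 + ν * m) / 2 / x + m * (2 * c / m) ^ 2 * x ^ (m - 1) *
    (besselNormalizedDeriv ν ((2 * c / m) ^ 2 * x ^ m)
      / besselNormalized ν ((2 * c / m) ^ 2 * x ^ m))

/-- The Riccati equation satisfied by `besselLogDeriv`. -/
lemma hasDerivAt_besselLogDeriv {m c x : ℝ} (hm : 0 < m) (hν : 0 < ν) (hx : 0 < x)
    (hpos : 0 < besselNormalized ν ((2 * c / m) ^ 2 * x ^ m)) :
    HasDerivAt (besselLogDeriv m ν c)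
      (- (besselLogDeriv m ν c x) ^ 2
        - ((1 - ν ^ 2 * m ^ 2) / 4 * (1 / x ^ 2) + c ^ 2 * (1 / x ^ ((2 : ℝ) - m)))) x := by
  set κ := (2 * c / m) ^ 2 with hκ
  have hin : HasDerivAt (fun x : ℝ => κ * x ^ m) (κ * (m * x ^ (m - 1))) x :=
    (Real.hasDerivAt_rpow_const (Or.inl hx.ne')).const_mul κ
  have hn := (hasDerivAt_besselNormalizedDeriv hν (κ * x ^ m)).comp x hin
  have hd := (hasDerivAt_besselNormalized hν (κ * x ^ m)).comp x hin
  have hp := (Real.hasDerivAt_rpow_const (x := x) (p := m - 1) (Or.inl hx.ne')).const_mul (m * κ)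
  have hi := (hasDerivAt_inv hx.ne').const_mul ((1 + ν * m) / 2)
  refine (hi.add (hp.mul (hn.div hd hpos.ne'))).congr_deriv ?_
  have hode := besselNormalized_ode hν (κ * x ^ m)
  have hm1 : x ^ (m - 1) = x ^ m / x := Real.rpow_sub_one hx.ne' m
  have hm2 : x ^ (m - 1 - 1) = x ^ m / x ^ 2 := by
    rw [Real.rpow_sub_one hx.ne', hm1]; field_simp
  have hm3 : x ^ ((2 : ℝ) - m) = x ^ 2 / x ^ m := by
    rw [Real.rpow_sub hx]; norm_num
  have hc2 : c ^ 2 = m ^ 2 * κ / 4 := by rw [hκ]; field_simp; ring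
  have hX : 0 < x ^ m := Real.rpow_pos_of_pos hx m
  simp only [besselLogDeriv, Pi.div_apply, Function.comp, ← hκ]
  clear hn hd hp hi hin
  clear_value κ
  rw [hm1, hm2, hm3, hc2]
  generalize besselNormalized ν (κ * x ^ m) = F at *
  generalize besselNormalizedDeriv ν (κ * x ^ m) = F₁ at *
  generalize besselNormalizedDeriv₂ ν (κ * x ^ m) = F₂ at *
  generalize x ^ m = X at *
  field_simp
  linear_combination (16 * m ^ 2 * κ * X * F) * hode

end Bessel

lemma setLIntegral_Icc_le_of_hasDerivAt {w y y' : ℝ → ℝ} {B t : ℝ} (ht : t ∈ Ioc (0 : ℝ) 1)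
    (hw : ∀ x ∈ Ioc (0 : ℝ) 1, 0 ≤ w x) (hwc : ContinuousOn w (Ioc 0 1))
    (hy : ∀ x ∈ Ioc (0 : ℝ) 1, HasDerivAt y (y' x) x)
    (hwy : ∀ x ∈ Ioc (0 : ℝ) 1, w x ≤ - y' x) (hy1 : 0 ≤ y 1) (hyB : y t ≤ B / t) :
    ∫⁻ x in Icc t 1, ENNReal.ofReal (w x) ≤ ENNReal.ofReal (B / t) := by
  have hsub : Icc t 1 ⊆ Ioc (0 : ℝ) 1 := fun x hx => ⟨ht.1.trans_le hx.1, hx.2⟩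
  have hint : IntegrableOn w (Icc t 1) := (hwc.mono hsub).integrableOn_Icc
  rw [← ofReal_integral_eq_lintegral_ofReal hint
    ((ae_restrict_iff' measurableSet_Icc).2 (ae_of_all _ fun x hx => hw x (hsub hx)))]
  refine ENNReal.ofReal_le_ofReal ?_
  rw [integral_Icc_eq_integral_Ioc, ← intervalIntegral.integral_of_le ht.2]
  have h := intervalIntegral.integral_le_sub_of_hasDeriv_right_of_le (g := fun x => - y x)
    (g' := fun x => - y' x) ht.2
    (fun x hx => (hy x (hsub hx)).neg.continuousAt.continuousWithinAt)
    (fun x hx => (hy x (hsub (Ioo_subset_Icc_self hx))).neg.hasDerivWithinAt) hint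
    (fun x hx => hwy x (hsub (Ioo_subset_Icc_self hx)))
  linarith

/-- A weighted Hardy inequality in `L¹`, obtained by exchanging the order of integration. -/
lemma lintegral_primitive_mul_le {f f' w : ℝ → ℝ} {B : ℝ} (hB : 0 ≤ B)
    (hf'int : IntegrableOn f' (Icc 0 1))
    (hf : ∀ x ∈ Icc (0:ℝ) 1, f x = ∫ t in (0:ℝ)..x, f' t)
    (hL1 : IntegrableOn (fun x => f' x / x) (Ioc 0 1))
    (hwc : ContinuousOn w (Ioc 0 1))
    (hwB : ∀ t ∈ Ioc (0 : ℝ) 1, ∫⁻ x in Icc t 1, ENNReal.ofReal (w x) ≤ ENNReal.ofReal (B / t)) :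
    ∫⁻ x in Ioc (0 : ℝ) 1, ENNReal.ofReal (|f x| * w x)
      ≤ ENNReal.ofReal (B * ∫ x in Ioc (0 : ℝ) 1, |f' x| / x) := by
  set μ := volume.restrict (Ioc (0 : ℝ) 1) with hμ
  have hf'm : AEMeasurable f' μ :=
    (hf'int.mono_set Ioc_subset_Icc_self).aestronglyMeasurable.aemeasurable
  have hwm : AEMeasurable w μ := hwc.aemeasurable measurableSet_Ioc
  set K : ℝ → ℝ → ENNReal := fun x t =>
    {p : ℝ × ℝ | p.2 ≤ p.1}.indicator (fun p => ‖f' p.2‖ₑ * ENNReal.ofReal (w p.1)) (x, t) with hK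
  have hKm : AEMeasurable (Function.uncurry K) (μ.prod μ) :=
    ((hf'm.enorm.comp_snd).mul (hwm.ennreal_ofReal.comp_fst)).indicator
      (measurableSet_le measurable_snd measurable_fst)
  have hleft : ∀ x ∈ Ioc (0 : ℝ) 1, ENNReal.ofReal (|f x| * w x) ≤ ∫⁻ t, K x t ∂μ := by
    intro x hx
    have h1 : ∫⁻ t, K x t ∂μ = (∫⁻ t in Ioc 0 x, ‖f' t‖ₑ) * ENNReal.ofReal (w x) := by
      have : ∀ t, K x t = (Iic x).indicator (fun t => ‖f' t‖ₑ * ENNReal.ofReal (w x)) t := by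
        intro t
        simp [hK, indicator_apply]
      simp_rw [this]
      rw [lintegral_indicator measurableSet_Iic, hμ, Measure.restrict_restrict measurableSet_Iic,
        show Iic x ∩ Ioc 0 1 = Ioc 0 x by
          ext t; simp only [mem_inter_iff, mem_Iic, mem_Ioc]; grind]
      exact lintegral_mul_const' _ _ ENNReal.ofReal_ne_top
    rw [h1, ENNReal.ofReal_mul (abs_nonneg _)]
    gcongr
    rw [hf x ⟨hx.1.le, hx.2⟩, intervalIntegral.integral_of_le hx.1.le, ← Real.enorm_eq_ofReal_abs]
    exact enorm_integral_le_lintegral_enorm _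
  have hright : ∀ t ∈ Ioc (0 : ℝ) 1, ∫⁻ x, K x t ∂μ ≤ ENNReal.ofReal (B * (|f' t| / t)) := by
    intro t ht
    have h1 : ∫⁻ x, K x t ∂μ = ‖f' t‖ₑ * ∫⁻ x in Icc t 1, ENNReal.ofReal (w x) := by
      have : ∀ x, K x t = (Ici t).indicator (fun x => ‖f' t‖ₑ * ENNReal.ofReal (w x)) x := by
        intro x
        simp [hK, indicator_apply]
      simp_rw [this]
      rw [lintegral_indicator measurableSet_Ici, hμ, Measure.restrict_restrict measurableSet_Ici,
        show Ici t ∩ Ioc 0 1 = Icc t 1 by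
          ext x; simp only [mem_inter_iff, mem_Ici, mem_Ioc, mem_Icc]; have := ht.1; grind]
      exact lintegral_const_mul' _ _ enorm_ne_top
    rw [h1, show B * (|f' t| / t) = |f' t| * (B / t) by ring, ENNReal.ofReal_mul (abs_nonneg _),
      ← Real.enorm_eq_ofReal_abs]
    gcongr
    exact hwB t ht
  have habs : Integrable (fun x => |f' x| / x) μ := by
    refine hL1.norm.congr ((ae_restrict_iff' measurableSet_Ioc).2 (ae_of_all _ fun x hx => ?_))
    simp [abs_of_pos hx.1]
  calc ∫⁻ x, ENNReal.ofReal (|f x| * w x) ∂μ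
      ≤ ∫⁻ x, ∫⁻ t, K x t ∂μ ∂μ := setLIntegral_mono' measurableSet_Ioc hleft
    _ = ∫⁻ t, ∫⁻ x, K x t ∂μ ∂μ := lintegral_lintegral_swap hKm
    _ ≤ ∫⁻ t, ENNReal.ofReal (B * (|f' t| / t)) ∂μ := setLIntegral_mono' measurableSet_Ioc hright
    _ = ENNReal.ofReal (∫ t, B * (|f' t| / t) ∂μ) := by
        refine (ofReal_integral_eq_lintegral_ofReal (habs.const_mul B)
          ((ae_restrict_iff' measurableSet_Ioc).2 (ae_of_all _ fun x hx => ?_))).symm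
        have := hx.1
        simp only [Pi.zero_apply]
        positivity
    _ = _ := by rw [integral_const_mul]

theorem stmt_4 (m ν c jν : ℝ) (f f' : ℝ → ℝ)
    (hm : 0 < m) (hν : ν ∈ Set.Ioc 0 (1 / m))
    (hc : 0 < c)
    (hjν_pos : 0 < jν) (hjν_zero : besselJ ν jν = 0)
    (hjν_first : ∀ t ∈ Set.Ioo 0 jν, 0 < besselJ ν t)
    (hcm : 2 * c / m ∈ Set.Ioo 0 jν)
    (hroot : besselJ ν (2 * c / m) + 2 * c * deriv (besselJ ν) (2 * c / m) = 0)
    (hf'int : IntegrableOn f' (Set.Icc 0 1))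
    (hf : ∀ x ∈ Set.Icc (0:ℝ) 1, f x = ∫ t in (0:ℝ)..x, f' t)
    (hL1 : IntegrableOn (fun x => f' x / x) (Set.Ioc 0 1)) :
    (1 - ν ^ 2 * m ^ 2) / 4 * (∫ x in Set.Ioc (0:ℝ) 1, |f x| / x ^ 2)
      + c ^ 2 * (∫ x in Set.Ioc (0:ℝ) 1, |f x| / x ^ ((2:ℝ) - m))
    ≤ (1 + ν * m) / 2 * (∫ x in Set.Ioc (0:ℝ) 1, |f' x| / x) := by
  obtain ⟨hν0, hν1⟩ := hν
  have ha : ν * m ≤ 1 := (le_div_iff₀ hm).1 hν1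
  have ha0 : 0 < ν * m := by positivity
  have hα : 0 ≤ (1 - ν ^ 2 * m ^ 2) / 4 := by nlinarith
  set z := 2 * c / m with hz
  have hΦpos : ∀ s ∈ Ioc 0 (z ^ 2), 0 < besselNormalized ν s := by
    intro s hs
    have hs' : 0 < √s := Real.sqrt_pos.2 hs.1
    have hsz : √s ≤ z := (Real.sqrt_le_left hcm.1.le).2 hs.2
    have h := hjν_first (√s) ⟨hs', hsz.trans_lt hcm.2⟩
    rw [besselJ_eq hs', Real.sq_sqrt hs.1.le] at h
    exact pos_of_mul_pos_right h (Real.rpow_nonneg hs'.le _)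
  have hmem : ∀ x ∈ Ioc (0 : ℝ) 1, z ^ 2 * x ^ m ∈ Ioc 0 (z ^ 2) := by
    intro x hx
    have h1 := Real.rpow_pos_of_pos hx.1 m
    have h2 := Real.rpow_le_one hx.1.le hx.2 hm.le
    have h3 : 0 < z ^ 2 := pow_pos hcm.1 2
    exact ⟨by positivity, mul_le_of_le_one_right h3.le h2⟩
  have hy1 : besselLogDeriv m ν c 1 = 0 := by
    have hF := hΦpos (z ^ 2) ⟨pow_pos hcm.1 2, le_rfl⟩
    have hzp := Real.rpow_pos_of_pos hcm.1 ν
    have hz0 := hcm.1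
    rw [(hasDerivAt_besselJ hν0 hcm.1).deriv, besselJ_eq hcm.1, Real.rpow_sub_one hcm.1.ne'] at hroot
    have hc' : c = m * z / 2 := by rw [hz]; field_simp
    simp only [besselLogDeriv, ← hz, Real.one_rpow, mul_one]
    have key : z ^ ν * ((1 + ν * m) * besselNormalized ν (z ^ 2)
        + 2 * m * z ^ 2 * besselNormalizedDeriv ν (z ^ 2)) = 0 := by
      rw [← hroot, hc']
      field_simp
      ring
    have key' := (mul_eq_zero.1 key).resolve_left hzp.ne'
    field_simp
    linear_combination key'
  have hyB : ∀ t ∈ Ioc (0 : ℝ) 1, besselLogDeriv m ν c t ≤ (1 + ν * m) / 2 / t := by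
    intro t ht
    have hs := hmem t ht
    have h1 := hΦpos _ hs
    have h2 := besselNormalizedDeriv_nonpos hν0 hs.1
      fun r hr => (hΦpos r ⟨hr.1, hr.2.le.trans hs.2⟩).le
    have h3 := div_nonpos_of_nonpos_of_nonneg h2 h1.le
    have h4 : 0 ≤ m * z ^ 2 * t ^ (m - 1) :=
      mul_nonneg (by positivity) (Real.rpow_nonneg ht.1.le _)
    have := mul_nonpos_of_nonneg_of_nonpos h4 h3
    simp only [besselLogDeriv, ← hz]
    linarith
  set w : ℝ → ℝ := fun x =>
    (1 - ν ^ 2 * m ^ 2) / 4 * (1 / x ^ 2) + c ^ 2 * (1 / x ^ ((2 : ℝ) - m)) with hw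
  have hc₁ : ContinuousOn (fun x : ℝ => 1 / x ^ 2) (Ioc 0 1) :=
    continuousOn_const.div (continuousOn_pow 2) fun x hx => (pow_pos hx.1 2).ne'
  have hc₂ : ContinuousOn (fun x : ℝ => 1 / x ^ ((2 : ℝ) - m)) (Ioc 0 1) :=
    continuousOn_const.div (continuousOn_id.rpow_const fun x hx => Or.inl hx.1.ne')
      fun x hx => (Real.rpow_pos_of_pos hx.1 _).ne'
  have hwc : ContinuousOn w (Ioc 0 1) := (hc₁.const_mul _).add (hc₂.const_mul _)
  have hw0 : ∀ x ∈ Ioc (0 : ℝ) 1, 0 ≤ w x := by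
    intro x hx
    have := Real.rpow_pos_of_pos hx.1 (2 - m)
    simp only [hw]
    positivity
  have hfm : AEStronglyMeasurable f (volume.restrict (Ioc 0 1)) := by
    have h1 : ContinuousOn f (Icc 0 1) :=
      (intervalIntegral.continuousOn_primitive_interval
        (by rwa [uIcc_of_le zero_le_one])).congr_mono hf (by rw [uIcc_of_le zero_le_one])
    exact (h1.mono Ioc_subset_Icc_self).aestronglyMeasurable measurableSet_Ioc
  have hI₁ : IntegrableOn (fun x => |f x| / x ^ 2) (Ioc 0 1) := by
    refine ⟨hfm.norm.div₀ (continuous_pow 2).aestronglyMeasurable, ?_⟩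
    rw [hasFiniteIntegral_iff_ofReal (ae_of_all _ fun x => by positivity)]
    simp_rw [div_eq_mul_one_div |f _|]
    refine (lintegral_primitive_mul_le zero_le_one hf'int hf hL1 hc₁ fun t ht =>
      setLIntegral_Icc_le_of_hasDerivAt ht (y := fun x => x⁻¹) (fun x hx => by positivity) hc₁
        (fun x hx => hasDerivAt_inv hx.1.ne') (fun x hx => by simp) (by simp) (by simp)).trans_lt
          ENNReal.ofReal_lt_top
  have hI₂ : IntegrableOn (fun x => |f x| / x ^ ((2 : ℝ) - m)) (Ioc 0 1) := by
    refine Integrable.mono hI₁ ?_ ((ae_restrict_iff' measurableSet_Ioc).2 (ae_of_all _ fun x hx => ?_))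
    · simp_rw [div_eq_mul_one_div |f _|]
      exact hfm.norm.mul (hc₂.aestronglyMeasurable measurableSet_Ioc)
    · have h0 := hx.1
      have h1 : x ^ 2 ≤ x ^ ((2 : ℝ) - m) := by
        rw [← Real.rpow_natCast]
        exact Real.rpow_le_rpow_of_exponent_ge hx.1 hx.2 (by push_cast; linarith)
      have h2 := Real.rpow_pos_of_pos hx.1 (2 - m)
      rw [Real.norm_of_nonneg (by positivity), Real.norm_of_nonneg (by positivity)]
      gcongr
  have hmain := lintegral_primitive_mul_le (w := w) (B := (1 + ν * m) / 2) (by positivity)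
    hf'int hf hL1 hwc fun t ht =>
      setLIntegral_Icc_le_of_hasDerivAt ht hw0 hwc
        (fun x hx => hasDerivAt_besselLogDeriv hm hν0 hx.1 (hΦpos _ (hmem x hx)))
        (fun x hx => by simp only [hw]; nlinarith [sq_nonneg (besselLogDeriv m ν c x)])
        hy1.ge (hyB t ht)
  have hsplit : ∀ x, |f x| * w x = (1 - ν ^ 2 * m ^ 2) / 4 * (|f x| / x ^ 2)
      + c ^ 2 * (|f x| / x ^ ((2 : ℝ) - m)) := fun x => by simp only [hw]; ring
  have hIw : IntegrableOn (fun x => |f x| * w x) (Ioc 0 1) := by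
    simp_rw [hsplit]
    exact (hI₁.const_mul _).add (hI₂.const_mul _)
  rw [← ofReal_integral_eq_lintegral_ofReal hIw ((ae_restrict_iff' measurableSet_Ioc).2
    (ae_of_all _ fun x hx => mul_nonneg (abs_nonneg _) (hw0 x hx)))] at hmain
  have hnn : 0 ≤ (1 + ν * m) / 2 * ∫ x in Ioc (0 : ℝ) 1, |f' x| / x :=
    mul_nonneg (by positivity) (setIntegral_nonneg measurableSet_Ioc fun x hx =>
      div_nonneg (abs_nonneg _) hx.1.le)
  have hfin := (ENNReal.ofReal_le_ofReal_iff hnn).1 hmain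
  simp_rw [hsplit] at hfin
  rwa [integral_add (hI₁.const_mul _) (hI₂.const_mul _), integral_const_mul,
    integral_const_mul] at hfin
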